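/- Let n ≥ 3 be an integer, set c = cos(2π/(3n)), L = 1/2 + c (so L > 1), let θ ∈ [0, π] satisfy cos θ = L/(L+1) (equivalently θ = arccos((2c+1)/(2c+3))), and define the complex 2×2 matrices A = [[L, √(L²−1)], [√(L²−1), L]], T = [[e^{iθ/2}, 0], [0, e^{−iθ/2}]], and B = T·A·T⁻¹ = [[L, e^{iθ}√(L²−1)], [e^{−iθ}√(L²−1), L]]. Then trace(A·B·A⁻¹·B⁻¹) = −2cos(2π/n). Moreover, in the degenerate case c = 1 (so L = 3/2 and cos θ = 3/5, sin θ = 4/5) one has A = [[3/2, √5/2], [√5/2, 3/2]], B = [[3/2, (3+4i)√5/10], [(3−4i)√5/10, 3/2]], and trace(A·B·A⁻¹·B⁻¹) = −2. -/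

import Mathlib

open Matrix

lemma aux_inv (L s t : ℂ) (h : L * L - s * t = 1) :
    (!![L, s; t, L] : Matrix (Fin 2) (Fin 2) ℂ)⁻¹ = !![L, -s; -t, L] := by
  apply Matrix.inv_eq_right_inv
  ext i j
  fin_cases i <;> fin_cases j <;> simp [Matrix.mul_apply, Fin.sum_univ_two] <;>
    first | linear_combination h | ring

lemma aux_conj (L s w : ℂ) :
    (!![Complex.exp (w / 2), 0; 0, Complex.exp (-(w / 2))] : Matrix (Fin 2) (Fin 2) ℂ)
      * !![L, s; s, L] * (!![Complex.exp (w / 2), 0; 0, Complex.exp (-(w / 2))])⁻¹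
      = !![L, Complex.exp w * s; Complex.exp (-w) * s, L] := by
  have h1 : Complex.exp (w / 2) * Complex.exp (-(w / 2)) = 1 := by
    rw [← Complex.exp_add]; simp
  have h2 : Complex.exp w = Complex.exp (w / 2) * Complex.exp (w / 2) := by
    rw [← Complex.exp_add]; ring_nf
  have h3 : Complex.exp (-w) = Complex.exp (-(w / 2)) * Complex.exp (-(w / 2)) := by
    rw [← Complex.exp_add]; ring_nf
  have hT : (!![Complex.exp (w / 2), 0; 0, Complex.exp (-(w / 2))] : Matrix (Fin 2) (Fin 2) ℂ)⁻¹
      = !![Complex.exp (-(w / 2)), 0; 0, Complex.exp (w / 2)] := by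
    apply Matrix.inv_eq_right_inv
    generalize Complex.exp (w / 2) = a at *
    generalize Complex.exp (-(w / 2)) = b at *
    ext i j
    fin_cases i <;> fin_cases j <;> simp [Matrix.mul_apply, Fin.sum_univ_two] <;>
      linear_combination h1
  rw [hT, h2, h3]
  generalize Complex.exp (w / 2) = a at *
  generalize Complex.exp (-(w / 2)) = b at *
  ext i j
  fin_cases i <;> fin_cases j <;> simp [Matrix.mul_apply, Fin.sum_univ_two]
  · linear_combination L * h1
  · ring
  · ring
  · linear_combination L * h1

lemma aux_trace (L s e f : ℂ) (hs : s * s = L * L - 1) (hef : e * f = 1)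
    (hk : (e + f) * (L + 1) = 2 * L) :
    ((!![L, s; s, L] : Matrix (Fin 2) (Fin 2) ℂ) * !![L, e * s; f * s, L]
      * (!![L, s; s, L])⁻¹ * (!![L, e * s; f * s, L])⁻¹).trace = 12 * L ^ 2 - 8 * L ^ 3 - 2 := by
  rw [aux_inv L s s (by linear_combination -hs),
    aux_inv L (e * s) (f * s) (by linear_combination -hs - s * s * hef)]
  have hz : s * s * (e + f) = 2 * L * (L - 1) := by
    rw [hs]; linear_combination (L - 1) * hk
  have key : ((!![L, s; s, L] : Matrix (Fin 2) (Fin 2) ℂ) * !![L, e * s; f * s, L]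
      * !![L, -s; -s, L] * !![L, -(e * s); -(f * s), L]).trace
      = 2 * L ^ 4 - 4 * L ^ 2 * (s * s) - 2 * L ^ 2 * (s * s) * (e * f)
        + 2 * L ^ 2 * (s * s) + 0 + (s * s * (e + f)) ^ 2 - 2 * (s * s) ^ 2 * (e * f) := by
    simp [Matrix.trace, Matrix.mul_apply, Fin.sum_univ_two]
    ring
  rw [key, hz, hef, hs]
  ring

lemma aux_exp (θ : ℝ) : Complex.exp (Complex.I * θ) = Real.cos θ + Real.sin θ * Complex.I := by
  rw [mul_comm, Complex.exp_mul_I]; simp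

lemma aux_exp' (θ : ℝ) :
    Complex.exp (-(Complex.I * θ)) = Real.cos θ - Real.sin θ * Complex.I := by
  rw [show -(Complex.I * θ) = (-θ : ℂ) * Complex.I by ring, Complex.exp_mul_I]
  simp [sub_eq_add_neg]

lemma aux_ef (w : ℂ) : Complex.exp w * Complex.exp (-w) = 1 := by
  rw [← Complex.exp_add]; simp

theorem stmt_3 :
    (∀ (n : ℕ), 3 ≤ n → ∀ (c L θ : ℝ),
      c = Real.cos (2 * Real.pi / (3 * n)) → L = 1 / 2 + c →
      θ ∈ Set.Icc 0 Real.pi → Real.cos θ = L / (L + 1) →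
      ∀ (A T B : Matrix (Fin 2) (Fin 2) ℂ),
        A = !![(L : ℂ), (Real.sqrt (L ^ 2 - 1) : ℂ);
               (Real.sqrt (L ^ 2 - 1) : ℂ), (L : ℂ)] →
        T = !![Complex.exp (Complex.I * θ / 2), 0;
               0, Complex.exp (-(Complex.I * θ / 2))] →
        B = T * A * T⁻¹ →
        1 < L ∧
        B = !![(L : ℂ), Complex.exp (Complex.I * θ) * (Real.sqrt (L ^ 2 - 1) : ℂ);
               Complex.exp (-(Complex.I * θ)) * (Real.sqrt (L ^ 2 - 1) : ℂ), (L : ℂ)] ∧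
        (A * B * A⁻¹ * B⁻¹).trace = -2 * (Real.cos (2 * Real.pi / n) : ℂ)) ∧
    (∀ (θ : ℝ), Real.cos θ = 3 / 5 → Real.sin θ = 4 / 5 →
      ∀ (A T B : Matrix (Fin 2) (Fin 2) ℂ),
        A = !![(((3 : ℝ) / 2 : ℝ) : ℂ), (Real.sqrt (((3 : ℝ) / 2) ^ 2 - 1) : ℂ);
               (Real.sqrt (((3 : ℝ) / 2) ^ 2 - 1) : ℂ), (((3 : ℝ) / 2 : ℝ) : ℂ)] →
        T = !![Complex.exp (Complex.I * θ / 2), 0;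
               0, Complex.exp (-(Complex.I * θ / 2))] →
        B = T * A * T⁻¹ →
        A = !![(3 / 2 : ℂ), (Real.sqrt 5 : ℂ) / 2;
               (Real.sqrt 5 : ℂ) / 2, (3 / 2 : ℂ)] ∧
        B = !![(3 / 2 : ℂ), (3 + 4 * Complex.I) * (Real.sqrt 5 : ℂ) / 10;
               (3 - 4 * Complex.I) * (Real.sqrt 5 : ℂ) / 10, (3 / 2 : ℂ)] ∧
        (A * B * A⁻¹ * B⁻¹).trace = -2) := by
  constructor
  · intro n hn c L θ hc hL hθ hcos A T B hA hT hB
    have hn' : (3 : ℝ) ≤ n := by exact_mod_cast hn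
    have hpi := Real.pi_pos
    have hc2 : 1 / 2 < c := by
      rw [hc, ← Real.cos_pi_div_three]
      apply Real.cos_lt_cos_of_nonneg_of_le_pi_div_two
      · positivity
      · linarith
      · rw [div_lt_div_iff₀ (by positivity) (by norm_num)]
        nlinarith
    have hL1 : 1 < L := by linarith
    have hs : (Real.sqrt (L ^ 2 - 1) : ℂ) * (Real.sqrt (L ^ 2 - 1) : ℂ) = L * L - 1 := by
      rw [← Complex.ofReal_mul, Real.mul_self_sqrt (by nlinarith)]
      push_cast; ring
    have hBf := hB
    rw [hT, hA, aux_conj] at hBf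
    refine ⟨hL1, hBf, ?_⟩
    have hcos' : Real.cos θ * (L + 1) = L := by
      rw [hcos]; field_simp
    have hcosC : (Real.cos θ : ℂ) * (L + 1) = L := by exact_mod_cast hcos'
    rw [hBf, hA, aux_trace _ _ _ _ hs (aux_ef _)
      (by rw [aux_exp, aux_exp']; linear_combination 2 * hcosC)]
    have h3 : Real.cos (2 * Real.pi / n) = 4 * c ^ 3 - 3 * c := by
      rw [hc, ← Real.cos_three_mul]; congr 1; field_simp
    rw [h3, hL]
    push_cast
    ring
  · intro θ hcos hsin A T B hA hT hB
    have hsq : Real.sqrt (((3 : ℝ) / 2) ^ 2 - 1) = Real.sqrt 5 / 2 := by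
      rw [Real.sqrt_eq_iff_mul_self_eq (by norm_num) (by positivity)]
      have := Real.mul_self_sqrt (show (0 : ℝ) ≤ 5 by norm_num)
      linarith
    have h5 : (Real.sqrt 5 : ℂ) * (Real.sqrt 5 : ℂ) = 5 := by
      exact_mod_cast Real.mul_self_sqrt (show (0 : ℝ) ≤ 5 by norm_num)
    rw [hsq] at hA
    have hA' : A = !![(3 / 2 : ℂ), (Real.sqrt 5 : ℂ) / 2;
               (Real.sqrt 5 : ℂ) / 2, (3 / 2 : ℂ)] := by
      rw [hA]; push_cast; rfl
    have hBf := hB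
    rw [hT, hA', aux_conj] at hBf
    refine ⟨hA', ?_, ?_⟩
    · rw [hBf, aux_exp, aux_exp', hcos, hsin]
      ext i j
      fin_cases i <;> fin_cases j <;> simp <;> ring
    · rw [hBf, hA', aux_trace _ _ _ _ (by linear_combination h5 / 4) (aux_ef _)
        (by rw [aux_exp, aux_exp', hcos, hsin]; push_cast; ring)]
      norm_num
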